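/- arXiv:2407.04872 — 2 statements merged into one kernel-verified Lean document; each statement's English description precedes it below -/
import Mathlib

section
/- Let s ∈ V and r ∈ ℕ. If d^{r+1}(s,u) = d^r(s,u) for every negative vertex u ∈ N, then every walk from s to any vertex v has length at least d^{r+1}(s,v); equivalently, d^h(s,v) = d^{r+1}(s,v) for every v ∈ V and every h ≥ r + 1. -/
open scoped Classical

variable {V : Type*}

/-- `l` is a (nonempty) walk in the edge set `E`: a list of at least one vertex,
with every consecutive pair of vertices being an edge of `E`.
A single-vertex list is the empty walk at that vertex. -/
def IsWalk (E : Set (V × V)) (l : List V) : Prop :=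
  l ≠ [] ∧ l.Chain' (fun a b => (a, b) ∈ E)

/-- `l` is a walk in `E` from `s` to `t`. -/
def IsWalkFrom (E : Set (V × V)) (l : List V) (s t : V) : Prop :=
  IsWalk E l ∧ l.head? = some s ∧ l.getLast? = some t

/-- The edges of a walk, in order, with multiplicity. -/
def walkEdges (l : List V) : List (V × V) := l.zip l.tail

/-- The length of a walk with respect to edge lengths `ℓ`. -/
noncomputable def walkLen (ℓ : V × V → ℝ) (l : List V) : ℝ :=
  ((walkEdges l).map ℓ).sum

/-- The tails of the negative edges along a walk, in order, with multiplicity. -/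
noncomputable def negTails (ℓ : V × V → ℝ) (l : List V) : List V :=
  ((walkEdges l).filter (fun p => ℓ p < 0)).map Prod.fst

/-- The number of hops (negative edges, counted with multiplicity) of a walk. -/
noncomputable def hops (ℓ : V × V → ℝ) (l : List V) : ℕ :=
  (negTails ℓ l).length

/-- The set of negative vertices: tails of negative edges. -/
def negVerts (E : Set (V × V)) (ℓ : V × V → ℝ) : Set V :=
  {u | ∃ v, (u, v) ∈ E ∧ ℓ (u, v) < 0}

/-- `r`-hop distance: infimum (in the extended reals) of lengths of walks
from `s` to `t` with at most `r` hops. -/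
noncomputable def hopDist (E : Set (V × V)) (ℓ : V × V → ℝ) (r : ℕ) (s t : V) : EReal :=
  sInf {x : EReal | ∃ l, IsWalkFrom E l s t ∧ hops ℓ l ≤ r ∧ x = (walkLen ℓ l : ℝ)}

/-- Distance: infimum (in the extended reals) of lengths of all walks from `s` to `t`. -/
noncomputable def dist' (E : Set (V × V)) (ℓ : V × V → ℝ) (s t : V) : EReal :=
  sInf {x : EReal | ∃ l, IsWalkFrom E l s t ∧ x = (walkLen ℓ l : ℝ)}

/-- Proper `h`-hop distance: infimum of lengths of walks from `s` to `t` with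
exactly `h` negative edges whose tails are pairwise distinct. -/
noncomputable def properHopDist (E : Set (V × V)) (ℓ : V × V → ℝ) (h : ℕ) (s t : V) : EReal :=
  sInf {x : EReal | ∃ l, IsWalkFrom E l s t ∧ hops ℓ l = h ∧ (negTails ℓ l).Nodup
    ∧ x = (walkLen ℓ l : ℝ)}

/-- `r`-hop distance from a set of sources. -/
noncomputable def hopDistFromSet (E : Set (V × V)) (ℓ : V × V → ℝ) (r : ℕ) (S : Set V)
    (t : V) : EReal :=
  ⨅ s ∈ S, hopDist E ℓ r s t

/-- `r`-hop distance to a set of sinks. -/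
noncomputable def hopDistToSet (E : Set (V × V)) (ℓ : V × V → ℝ) (r : ℕ) (s : V)
    (T : Set V) : EReal :=
  ⨅ t ∈ T, hopDist E ℓ r s t

/-- `φ` is a valid potential for edge lengths `ℓ`: reweighting introduces no new
negative edges. -/
def ValidPotential (E : Set (V × V)) (ℓ : V × V → ℝ) (φ : V → ℝ) : Prop :=
  ∀ e ∈ E, 0 ≤ ℓ e → 0 ≤ ℓ e + φ e.1 - φ e.2

/-- The reweighted edge lengths `ℓ_φ`. -/
def reweight (ℓ : V × V → ℝ) (φ : V → ℝ) : V × V → ℝ :=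
  fun e => ℓ e + φ e.1 - φ e.2

theorem walkEdges_append_singleton {V : Type*} {l : List V} {u : V} (w : V)
    (hu : l.getLast? = some u) : walkEdges (l ++ [w]) = walkEdges l ++ [(u, w)] := by
  induction l with
  | nil => simp at hu
  | cons a t ih =>
    cases t with
    | nil =>
      have h : a = u := by simpa using hu
      simp [walkEdges, h]
    | cons b t =>
      have h := ih (by simpa using hu)
      simpa [walkEdges] using h

theorem walkLen_append_singleton {V : Type*} (ℓ : V × V → ℝ) {l : List V} {u : V} (w : V)
    (hu : l.getLast? = some u) : walkLen ℓ (l ++ [w]) = walkLen ℓ l + ℓ (u, w) := by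
  simp [walkLen, walkEdges_append_singleton w hu]

theorem hops_append_singleton {V : Type*} (ℓ : V × V → ℝ) {l : List V} {u : V} (w : V)
    (hu : l.getLast? = some u) :
    hops ℓ (l ++ [w]) = hops ℓ l + if ℓ (u, w) < 0 then 1 else 0 := by
  by_cases h : ℓ (u, w) < 0 <;>
    simp [hops, negTails, walkEdges_append_singleton w hu, List.filter_append, h]

theorem IsWalkFrom.append_singleton {V : Type*} {E : Set (V × V)} {l : List V} {s u w : V}
    (hl : IsWalkFrom E l s u) (he : (u, w) ∈ E) : IsWalkFrom E (l ++ [w]) s w := by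
  obtain ⟨⟨hne, hc⟩, hs, hu⟩ := hl
  refine ⟨⟨by simp, ?_⟩, by simp [hs], by simp⟩
  refine List.isChain_append.2 ⟨hc, by simp, ?_⟩
  intro x hx y hy
  simp_all

theorem hopDist_le_walkLen {V : Type*} {E : Set (V × V)} (ℓ : V × V → ℝ) {r : ℕ} {s t : V}
    {l : List V} (hl : IsWalkFrom E l s t) (hr : hops ℓ l ≤ r) :
    hopDist E ℓ r s t ≤ (walkLen ℓ l : EReal) :=
  sInf_le ⟨l, hl, hr, rfl⟩

theorem hopDist_anti {V : Type*} (E : Set (V × V)) (ℓ : V × V → ℝ) {r k : ℕ} (h : r ≤ k)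
    (s t : V) : hopDist E ℓ k s t ≤ hopDist E ℓ r s t :=
  sInf_le_sInf fun _ ⟨l, hl, hr, hx⟩ => ⟨l, hl, hr.trans h, hx⟩

/-- Triangle inequality for hop distances along a single edge. -/
theorem hopDist_le_add_edge {V : Type*} {E : Set (V × V)} (ℓ : V × V → ℝ) {r k : ℕ} {s u w : V}
    (he : (u, w) ∈ E) (hk : (r + if ℓ (u, w) < 0 then 1 else 0) ≤ k) :
    hopDist E ℓ k s w ≤ hopDist E ℓ r s u + (ℓ (u, w) : EReal) := by
  have key : hopDist E ℓ k s w - (ℓ (u, w) : EReal) ≤ hopDist E ℓ r s u := by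
    refine le_sInf ?_
    rintro _ ⟨l, hl, hr, rfl⟩
    refine EReal.sub_le_of_le_add ?_
    have h := hopDist_le_walkLen ℓ (hl.append_singleton he)
      ((hops_append_singleton ℓ w hl.2.2).le.trans ((Nat.add_le_add_right hr _).trans hk))
    rwa [walkLen_append_singleton ℓ w hl.2.2, EReal.coe_add] at h
  exact (EReal.sub_le_iff_le_add (.inl (EReal.coe_ne_bot _)) (.inl (EReal.coe_ne_top _))).1 key

theorem hopDist_succ_le_walkLen_of_stable {V : Type*} {E : Set (V × V)} {ℓ : V × V → ℝ}
    {s : V} {r : ℕ}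
    (hstab : ∀ u ∈ negVerts E ℓ, hopDist E ℓ (r + 1) s u = hopDist E ℓ r s u)
    {v : V} {l : List V} (hl : IsWalkFrom E l s v) :
    hopDist E ℓ (r + 1) s v ≤ (walkLen ℓ l : EReal) := by
  induction l using List.reverseRecOn generalizing v with
  | nil => exact absurd rfl hl.1.1
  | append_singleton l w ih =>
    rcases hu : l.getLast? with _ | u
    · obtain rfl : l = [] := by simpa using hu
      exact hopDist_le_walkLen ℓ hl (by simp [hops, negTails, walkEdges])
    · obtain ⟨⟨-, hc⟩, hs, hv⟩ := hl
      obtain rfl : w = v := by simpa using hv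
      have hne : l ≠ [] := by rintro rfl; simp at hu
      obtain ⟨hcl, -, hlast⟩ := List.isChain_append.1 hc
      have he : (u, w) ∈ E := hlast u hu w (by simp)
      have hl' : IsWalkFrom E l s u :=
        ⟨⟨hne, hcl⟩, by rwa [List.head?_append_of_ne_nil _ hne] at hs, hu⟩
      have step : hopDist E ℓ (r + 1) s w ≤ hopDist E ℓ (r + 1) s u + (ℓ (u, w) : EReal) := by
        by_cases hneg : ℓ (u, w) < 0
        · rw [hstab u ⟨w, he, hneg⟩]
          exact hopDist_le_add_edge ℓ he (by simp [hneg])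
        · exact hopDist_le_add_edge ℓ he (by simp [hneg])
      rw [walkLen_append_singleton ℓ w hu, EReal.coe_add]
      exact step.trans (add_le_add_left (ih hl') _)

/-- If `d^{r+1}(s,u) = d^r(s,u)` for every negative vertex `u`, then
every walk from `s` to any vertex `v` has length at least `d^{r+1}(s,v)`; equivalently,
`d^h(s,v) = d^{r+1}(s,v)` for every `v` and every `h ≥ r + 1`. -/
theorem statement5 {V : Type*} [Fintype V] (E : Set (V × V)) (ℓ : V × V → ℝ)
    (s : V) (r : ℕ)
    (hstab : ∀ u ∈ negVerts E ℓ, hopDist E ℓ (r + 1) s u = hopDist E ℓ r s u) :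
    (∀ (v : V) (l : List V), IsWalkFrom E l s v →
      hopDist E ℓ (r + 1) s v ≤ (walkLen ℓ l : EReal)) ∧
    (∀ (v : V) (h : ℕ), r + 1 ≤ h → hopDist E ℓ h s v = hopDist E ℓ (r + 1) s v) := by
  have hmin : ∀ (v : V) (l : List V), IsWalkFrom E l s v →
      hopDist E ℓ (r + 1) s v ≤ (walkLen ℓ l : EReal) :=
    fun _ _ hl => hopDist_succ_le_walkLen_of_stable hstab hl
  refine ⟨hmin, fun v h hr => le_antisymm (hopDist_anti E ℓ hr s v) (le_sInf ?_)⟩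
  rintro _ ⟨l, hl, -, rfl⟩
  exact hmin v l hl
end

section
/- Every edge of G' of the form (u⁺, v⁻) has nonnegative length; hence every negative edge of G' is of the form (v⁻, v⁺) for some v ∈ V, and is the unique outgoing edge of its tail v⁻. Moreover, for all u, v ∈ V, the walks from u⁻ to v⁻ in G' are in length-preserving correspondence with the walks from u to v in G; in particular d'(u⁻, v⁻) = d(u, v). -/
open scoped Classical

variable {V : Type*}

/-- The edges of the split graph: `(v⁻, v⁺)` for each vertex `v`, and `(u⁺, v⁻)` for each edge
`(u, v)` of `E`, where `v⁻ = Sum.inl v` and `v⁺ = Sum.inr v`. -/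
def splitEdges (E : Set (V × V)) : Set ((V ⊕ V) × (V ⊕ V)) :=
  {e | (∃ v : V, e = (Sum.inl v, Sum.inr v)) ∨
    (∃ u v : V, (u, v) ∈ E ∧ e = (Sum.inr u, Sum.inl v))}

@[simp]
theorem inl_mem_splitEdges {E : Set (V × V)} {u : V} {y : V ⊕ V} :
    (Sum.inl u, y) ∈ splitEdges E ↔ y = Sum.inr u := by
  simp only [splitEdges, Set.mem_ofPred_eq, Prod.mk.injEq, Sum.inl.injEq, reduceCtorEq,
    false_and, and_false, exists_false, or_false]
  exact ⟨by rintro ⟨v, rfl, rfl⟩; rfl, fun h => ⟨u, rfl, h⟩⟩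

@[simp]
theorem inr_mem_splitEdges {E : Set (V × V)} {u : V} {y : V ⊕ V} :
    (Sum.inr u, y) ∈ splitEdges E ↔ ∃ v, (u, v) ∈ E ∧ y = Sum.inl v := by
  simp only [splitEdges, Set.mem_ofPred_eq, Prod.mk.injEq, Sum.inr.injEq, reduceCtorEq,
    false_and, exists_false, false_or]
  exact ⟨by rintro ⟨_, v, h, rfl, rfl⟩; exact ⟨v, h, rfl⟩,
    fun ⟨v, h, hy⟩ => ⟨u, v, h, rfl, hy⟩⟩

/-- The walk in the split graph obtained by routing every edge `(u, v)` of a walk through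
`u⁻, u⁺, v⁻`. -/
def splitWalk : List V → List (V ⊕ V)
  | [] => []
  | [a] => [Sum.inl a]
  | a :: b :: l => Sum.inl a :: Sum.inr a :: splitWalk (b :: l)

theorem head?_splitWalk (l : List V) : (splitWalk l).head? = l.head?.map Sum.inl := by
  rcases l with _ | ⟨a, _ | ⟨b, l⟩⟩ <;> rfl

theorem splitWalk_cons_ne_nil (a : V) (l : List V) : splitWalk (a :: l) ≠ [] := by
  rcases l with _ | ⟨b, l⟩ <;> simp [splitWalk]

theorem exists_splitWalk_cons (a : V) (l : List V) :
    ∃ t, splitWalk (a :: l) = Sum.inl a :: t := by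
  rcases l with _ | ⟨b, l⟩ <;> simp [splitWalk]

theorem getLast?_splitWalk (l : List V) : (splitWalk l).getLast? = l.getLast?.map Sum.inl := by
  induction l with
  | nil => rfl
  | cons a l ih =>
    rcases l with _ | ⟨b, l⟩
    · rfl
    · obtain ⟨t, ht⟩ := exists_splitWalk_cons b l
      rw [ht] at ih
      simp only [splitWalk, ht, List.getLast?_cons_cons, ih]

theorem splitWalk_injective : Function.Injective (splitWalk (V := V)) := by
  intro l
  induction l with
  | nil =>
    rintro (_ | ⟨a, m⟩) h
    · rfl
    · exact absurd h.symm (splitWalk_cons_ne_nil a m)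
  | cons a l ih =>
    rintro (_ | ⟨c, m⟩) h
    · exact absurd h (splitWalk_cons_ne_nil a l)
    · rcases l with _ | ⟨b, l⟩ <;> rcases m with _ | ⟨d, m⟩ <;> simp [splitWalk] at h
      · rw [h]
      · rw [h.1, ih h.2]

theorem isChain_splitWalk {E : Set (V × V)} (l : List V) :
    (splitWalk l).IsChain (fun a b => (a, b) ∈ splitEdges E) ↔
      l.IsChain (fun a b => (a, b) ∈ E) := by
  induction l with
  | nil => simp [splitWalk]
  | cons a l ih =>
    rcases l with _ | ⟨b, l⟩
    · simp [splitWalk]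
    · obtain ⟨t, ht⟩ := exists_splitWalk_cons b l
      rw [ht] at ih
      simp [splitWalk, ht, ih]

theorem isWalkFrom_splitWalk {E : Set (V × V)} {l : List V} {u v : V} :
    IsWalkFrom (splitEdges E) (splitWalk l) (Sum.inl u) (Sum.inl v) ↔ IsWalkFrom E l u v := by
  have hnil : splitWalk l ≠ [] ↔ l ≠ [] := splitWalk_injective.ne_iff (y := [])
  have hchain := isChain_splitWalk (E := E) l
  simp only [IsWalkFrom, IsWalk, hnil, head?_splitWalk, getLast?_splitWalk,
    Option.map_eq_some_iff, Sum.inl.injEq, exists_eq_right]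
  exact and_congr_left fun _ => and_congr_right fun _ => hchain

theorem exists_splitWalk_eq {E : Set (V × V)} {v : V} :
    ∀ {l' : List (V ⊕ V)} {u : V},
      IsWalkFrom (splitEdges E) l' (Sum.inl u) (Sum.inl v) → ∃ l, splitWalk l = l'
  | [], _, h => ⟨[], rfl⟩
  | [x], u, ⟨_, hx, _⟩ => by
    obtain rfl : x = Sum.inl u := by simpa using hx
    exact ⟨[u], rfl⟩
  | [x, y], u, ⟨⟨_, hc⟩, hx, hy⟩ => by
    obtain rfl : x = Sum.inl u := by simpa using hx
    obtain rfl : y = Sum.inl v := by simpa using hy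
    have hc : List.IsChain _ _ := hc
    simp at hc
  | x :: y :: z :: t, u, ⟨⟨_, hc⟩, hx, ht⟩ => by
    obtain rfl : x = Sum.inl u := by simpa using hx
    have hc : List.IsChain _ _ := hc
    rw [List.isChain_cons_cons, inl_mem_splitEdges, List.isChain_cons_cons] at hc
    obtain ⟨rfl, hyz, hc⟩ := hc
    obtain ⟨w, -, rfl⟩ := inr_mem_splitEdges.1 hyz
    obtain ⟨l, hl⟩ := exists_splitWalk_eq (l' := Sum.inl w :: t) (u := w)
      ⟨⟨by simp, hc⟩, rfl, by simpa using ht⟩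
    rcases l with _ | ⟨b, l⟩
    · simp [splitWalk] at hl
    · exact ⟨u :: b :: l, by rw [splitWalk, hl]⟩

@[simp]
theorem walkLen_cons_cons (ℓ : V × V → ℝ) (a b : V) (l : List V) :
    walkLen ℓ (a :: b :: l) = ℓ (a, b) + walkLen ℓ (b :: l) := by
  simp [walkLen, walkEdges]

theorem walkLen_splitWalk {ℓ : V × V → ℝ} {μ : V → ℝ} {ℓ' : (V ⊕ V) × (V ⊕ V) → ℝ}
    (h₁ : ∀ v, ℓ' (Sum.inl v, Sum.inr v) = μ v)
    (h₂ : ∀ u v, ℓ' (Sum.inr u, Sum.inl v) = ℓ (u, v) - μ u) (l : List V) :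
    walkLen ℓ' (splitWalk l) = walkLen ℓ l := by
  induction l with
  | nil => simp [splitWalk, walkLen, walkEdges]
  | cons a l ih =>
    rcases l with _ | ⟨b, l⟩
    · simp [splitWalk, walkLen, walkEdges]
    · obtain ⟨t, ht⟩ := exists_splitWalk_cons b l
      rw [ht] at ih
      simp only [splitWalk, ht, walkLen_cons_cons, ih, h₁, h₂]
      ring

theorem dist'_splitEdges {ℓ : V × V → ℝ} {μ : V → ℝ} {ℓ' : (V ⊕ V) × (V ⊕ V) → ℝ}
    (h₁ : ∀ v, ℓ' (Sum.inl v, Sum.inr v) = μ v)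
    (h₂ : ∀ u v, ℓ' (Sum.inr u, Sum.inl v) = ℓ (u, v) - μ u) (E : Set (V × V)) (u v : V) :
    dist' (splitEdges E) ℓ' (Sum.inl u) (Sum.inl v) = dist' E ℓ u v := by
  unfold dist'
  congr 1
  ext x
  constructor
  · rintro ⟨l', hl', rfl⟩
    obtain ⟨l, rfl⟩ := exists_splitWalk_eq hl'
    exact ⟨l, isWalkFrom_splitWalk.1 hl', by rw [walkLen_splitWalk h₁ h₂]⟩
  · rintro ⟨l, hl, rfl⟩
    exact ⟨splitWalk l, isWalkFrom_splitWalk.2 hl, by rw [walkLen_splitWalk h₁ h₂]⟩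

/-- In the split graph `G'` (with vertices `v⁻ = Sum.inl v` and
`v⁺ = Sum.inr v`, an edge `(v⁻, v⁺)` of length `μ_v` for every `v`, and an edge
`(u⁺, v⁻)` of length `ℓ(u,v) - μ_u` for every edge `(u,v)` of `G`, where `μ_v` is the
minimum length of the edges leaving `v`): every edge of the form `(u⁺, v⁻)` has
nonnegative length; every negative edge is of the form `(v⁻, v⁺)` and is the unique
outgoing edge of its tail `v⁻`; and the walks from `u⁻` to `v⁻` in `G'` are in
length-preserving bijective correspondence with the walks from `u` to `v` in `G`;
in particular `d'(u⁻, v⁻) = d(u, v)`. -/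
theorem statement13 {V : Type*} [Fintype V] (E : Set (V × V)) (ℓ : V × V → ℝ)
    (hout : ∀ v : V, ∃ x, (v, x) ∈ E)
    (μ : V → ℝ)
    (hμmem : ∀ v : V, ∃ x, (v, x) ∈ E ∧ ℓ (v, x) = μ v)
    (hμmin : ∀ v x : V, (v, x) ∈ E → μ v ≤ ℓ (v, x))
    (E' : Set ((V ⊕ V) × (V ⊕ V)))
    (hE' : E' = {e | (∃ v : V, e = (Sum.inl v, Sum.inr v)) ∨
      (∃ u v : V, (u, v) ∈ E ∧ e = (Sum.inr u, Sum.inl v))})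
    (ℓ' : (V ⊕ V) × (V ⊕ V) → ℝ)
    (hℓ'₁ : ∀ v : V, ℓ' (Sum.inl v, Sum.inr v) = μ v)
    (hℓ'₂ : ∀ u v : V, ℓ' (Sum.inr u, Sum.inl v) = ℓ (u, v) - μ u) :
    (∀ u v : V, (Sum.inr u, Sum.inl v) ∈ E' → 0 ≤ ℓ' (Sum.inr u, Sum.inl v)) ∧
    (∀ e ∈ E', ℓ' e < 0 → ∃ v : V, e = (Sum.inl v, Sum.inr v)) ∧
    (∀ v : V, ∀ e ∈ E', e.1 = Sum.inl v → e.2 = Sum.inr v) ∧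
    (∀ u v : V, ∃ f : {l : List V // IsWalkFrom E l u v} →
        {l' : List (V ⊕ V) // IsWalkFrom E' l' (Sum.inl u) (Sum.inl v)},
      Function.Bijective f ∧ ∀ l, walkLen ℓ' (f l).1 = walkLen ℓ l.1) ∧
    (∀ u v : V, dist' E' ℓ' (Sum.inl u) (Sum.inl v) = dist' E ℓ u v) := by
  obtain rfl : E' = splitEdges E := hE'
  have hnonneg : ∀ u v : V, (Sum.inr u, Sum.inl v) ∈ splitEdges E →
      0 ≤ ℓ' (Sum.inr u, Sum.inl v) := by
    intro u v h
    have huv : (u, v) ∈ E := by simpa using h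
    rw [hℓ'₂]
    exact sub_nonneg.2 (hμmin u v huv)
  refine ⟨hnonneg, ?_, ?_, fun u v => ?_, dist'_splitEdges hℓ'₁ hℓ'₂ E⟩
  · rintro e (h | ⟨u, v, huv, rfl⟩) hneg
    · exact h
    · exact absurd (hnonneg u v (Or.inr ⟨u, v, huv, rfl⟩)) hneg.not_ge
  · rintro v ⟨x, y⟩ he rfl
    exact inl_mem_splitEdges.1 he
  · refine ⟨fun l => ⟨splitWalk l.1, isWalkFrom_splitWalk.2 l.2⟩, ⟨fun l m h => ?_, ?_⟩,
      fun l => walkLen_splitWalk hℓ'₁ hℓ'₂ l.1⟩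
    · exact Subtype.ext (splitWalk_injective (congrArg Subtype.val h))
    · rintro ⟨l', hl'⟩
      obtain ⟨l, rfl⟩ := exists_splitWalk_eq hl'
      exact ⟨⟨l, isWalkFrom_splitWalk.1 hl'⟩, rfl⟩
end
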